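/- There exists a 4-regular matchstick graph with exactly 70 vertices. -/

import Mathlib

open scoped Classical

/-- A matchstick graph: a finite set of points in the Euclidean plane together with
a finite set of unit-length non-crossing straight edges between distinct points. -/
structure MatchstickGraph where
  V : Finset (EuclideanSpace ℝ (Fin 2))
  E : Finset (Sym2 (EuclideanSpace ℝ (Fin 2)))
  edge_mem : ∀ e ∈ E, ∀ u v : EuclideanSpace ℝ (Fin 2), e = s(u, v) → u ∈ V ∧ v ∈ V
  edge_ne : ∀ e ∈ E, ¬ e.IsDiag
  edge_unit : ∀ e ∈ E, ∀ u v : EuclideanSpace ℝ (Fin 2), e = s(u, v) → dist u v = 1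
  noncross : ∀ e₁ ∈ E, ∀ e₂ ∈ E, e₁ ≠ e₂ →
    ∀ u v x y : EuclideanSpace ℝ (Fin 2), e₁ = s(u, v) → e₂ = s(x, y) →
      segment ℝ u v ∩ segment ℝ x y ⊆ (({u, v} : Set (EuclideanSpace ℝ (Fin 2))) ∩ {x, y})

/-- The degree of a vertex: the number of edges containing it. -/
noncomputable def MatchstickGraph.degree (G : MatchstickGraph)
    (v : EuclideanSpace ℝ (Fin 2)) : ℕ :=
  (G.E.filter (fun e => v ∈ e)).card

/-- A matchstick graph is 4-regular if every vertex has degree 4. -/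
def MatchstickGraph.IsFourRegular (G : MatchstickGraph) : Prop :=
  ∀ v ∈ G.V, G.degree v = 4

/-- A matchstick graph is (2,4)-regular if every vertex has degree 2 or degree 4. -/
def MatchstickGraph.IsTwoFourRegular (G : MatchstickGraph) : Prop :=
  ∀ v ∈ G.V, G.degree v = 2 ∨ G.degree v = 4

/-- Newton's method with a fixed approximate inverse `(a, b)` of the Jacobian matrix converges to an
exact solution of a system of unit distance equations. -/
theorem exists_unit_distances {V : Type*} {n : ℕ} (p q : Fin n → V) (x y : V → ℝ)
    (a b : V → Fin n → ℝ) {M ρ : ℝ} (hM : 0 ≤ M) (hρ : 0 ≤ ρ) (hMρ : 64 * M ^ 2 * ρ ≤ 1)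
    (ha : ∀ v, ∑ k, |a v k| ≤ M) (hb : ∀ v, ∑ k, |b v k| ≤ M)
    (hres : ∀ e, |(x (p e) - x (q e)) ^ 2 + (y (p e) - y (q e)) ^ 2 - 1| ≤ ρ / 2)
    (hjac : ∀ e, ∑ k, |(if e = k then 1 else 0) - 2 * (x (p e) - x (q e)) * (a (p e) k - a (q e) k)
      - 2 * (y (p e) - y (q e)) * (b (p e) k - b (q e) k)| ≤ 1 / 4) :
    ∃ X Y : V → ℝ,
      (∀ v, |X v - x v| ≤ M * ρ ∧ ((∀ k, a v k = 0) → X v = x v)) ∧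
      (∀ v, |Y v - y v| ≤ M * ρ ∧ ((∀ k, b v k = 0) → Y v = y v)) ∧
      ∀ e, (X (p e) - X (q e)) ^ 2 + (Y (p e) - Y (q e)) ^ 2 = 1 := by
  have hlin : ∀ (c : Fin n → ℝ) (C : ℝ), ∑ k, |c k| ≤ C → ∀ t : Fin n → ℝ,
      |∑ k, c k * t k| ≤ C * ‖t‖ := by
    intro c C hc t
    calc |∑ k, c k * t k| ≤ ∑ k, |c k * t k| := Finset.abs_sum_le_sum_abs _ _
      _ ≤ ∑ k, |c k| * ‖t‖ := by
          refine Finset.sum_le_sum fun k _ => ?_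
          rw [abs_mul]
          exact mul_le_mul_of_nonneg_left (norm_le_pi_norm t k) (abs_nonneg _)
      _ ≤ C * ‖t‖ := by
          rw [← Finset.sum_mul]
          exact mul_le_mul_of_nonneg_right hc (norm_nonneg t)
  let X : (Fin n → ℝ) → V → ℝ := fun t v => x v + ∑ k, a v k * t k
  let Y : (Fin n → ℝ) → V → ℝ := fun t v => y v + ∑ k, b v k * t k
  let G : (Fin n → ℝ) → Fin n → ℝ := fun t e =>
    t e - ((X t (p e) - X t (q e)) ^ 2 + (Y t (p e) - Y t (q e)) ^ 2 - 1)
  have hX : ∀ (v : V) (t : Fin n → ℝ), |∑ k, a v k * t k| ≤ M * ‖t‖ := fun v t => hlin _ _ (ha v) t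
  have hY : ∀ (v : V) (t : Fin n → ℝ), |∑ k, b v k * t k| ≤ M * ‖t‖ := fun v t => hlin _ _ (hb v) t
  have hquad : ∀ A B C D R : ℝ, |A| ≤ M * ρ → |B| ≤ M * ρ → |C| ≤ M * R → |D| ≤ M * R → 0 ≤ R →
      |(A - B) * (C - D)| ≤ 4 * (M ^ 2 * ρ) * R := by
    intro A B C D R hA hB hC hD hR
    rw [abs_mul]
    calc |A - B| * |C - D| ≤ (2 * (M * ρ)) * (2 * (M * R)) := by
          refine mul_le_mul ?_ ?_ (abs_nonneg _) (by positivity)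
          · linarith [abs_sub A B]
          · linarith [abs_sub C D]
      _ = 4 * (M ^ 2 * ρ) * R := by ring
  have hG : ∀ s t, ‖s‖ ≤ ρ → ‖t‖ ≤ ρ → ‖G s - G t‖ ≤ 1 / 2 * ‖s - t‖ := by
    intro s t hs ht
    rw [pi_norm_le_iff_of_nonneg (by positivity)]
    intro e
    have hsub : ∀ c : Fin n → ℝ, ∑ k, c k * (s - t) k = ∑ k, c k * s k - ∑ k, c k * t k := by
      intro c
      simp [mul_sub, Finset.sum_sub_distrib]
    have hsum : ∑ k, ((if e = k then 1 else 0)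
        - 2 * (x (p e) - x (q e)) * (a (p e) k - a (q e) k)
        - 2 * (y (p e) - y (q e)) * (b (p e) k - b (q e) k)) * (s - t) k
        = (s e - t e)
          - 2 * (x (p e) - x (q e)) * (∑ k, a (p e) k * (s - t) k - ∑ k, a (q e) k * (s - t) k)
          - 2 * (y (p e) - y (q e)) *
            (∑ k, b (p e) k * (s - t) k - ∑ k, b (q e) k * (s - t) k) := by
      have hδ : s e - t e = ∑ k, (if e = k then 1 else 0) * (s - t) k := by simp
      rw [hδ, ← Finset.sum_sub_distrib, ← Finset.sum_sub_distrib, Finset.mul_sum, Finset.mul_sum,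
        ← Finset.sum_sub_distrib, ← Finset.sum_sub_distrib]
      exact Finset.sum_congr rfl fun k _ => by ring
    have h0 := hlin _ _ (hjac e) (s - t)
    rw [hsum] at h0
    have hb1 : ∀ r : Fin n → ℝ, ‖r‖ ≤ ρ → ∀ v, |∑ k, a v k * r k| ≤ M * ρ := fun r hr v =>
      (hX v r).trans (mul_le_mul_of_nonneg_left hr hM)
    have hb2 : ∀ r : Fin n → ℝ, ‖r‖ ≤ ρ → ∀ v, |∑ k, b v k * r k| ≤ M * ρ := fun r hr v =>
      (hY v r).trans (mul_le_mul_of_nonneg_left hr hM)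
    have q1 := hquad _ _ _ _ _ (hb1 s hs (p e)) (hb1 s hs (q e)) (hX (p e) (s - t))
      (hX (q e) (s - t)) (norm_nonneg _)
    have q2 := hquad _ _ _ _ _ (hb1 t ht (p e)) (hb1 t ht (q e)) (hX (p e) (s - t))
      (hX (q e) (s - t)) (norm_nonneg _)
    have q3 := hquad _ _ _ _ _ (hb2 s hs (p e)) (hb2 s hs (q e)) (hY (p e) (s - t))
      (hY (q e) (s - t)) (norm_nonneg _)
    have q4 := hquad _ _ _ _ _ (hb2 t ht (p e)) (hb2 t ht (q e)) (hY (p e) (s - t))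
      (hY (q e) (s - t)) (norm_nonneg _)
    have hR : 16 * (M ^ 2 * ρ) * ‖s - t‖ ≤ 1 / 4 * ‖s - t‖ :=
      mul_le_mul_of_nonneg_right (by linarith) (norm_nonneg _)
    simp only [hsub] at h0 q1 q2 q3 q4
    have hval : (G s - G t) e = ((s e - t e)
        - 2 * (x (p e) - x (q e)) * ((∑ k, a (p e) k * s k - ∑ k, a (p e) k * t k)
          - (∑ k, a (q e) k * s k - ∑ k, a (q e) k * t k))
        - 2 * (y (p e) - y (q e)) * ((∑ k, b (p e) k * s k - ∑ k, b (p e) k * t k)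
          - (∑ k, b (q e) k * s k - ∑ k, b (q e) k * t k)))
        - (∑ k, a (p e) k * s k - ∑ k, a (q e) k * s k)
          * ((∑ k, a (p e) k * s k - ∑ k, a (p e) k * t k)
            - (∑ k, a (q e) k * s k - ∑ k, a (q e) k * t k))
        - (∑ k, a (p e) k * t k - ∑ k, a (q e) k * t k)
          * ((∑ k, a (p e) k * s k - ∑ k, a (p e) k * t k)
            - (∑ k, a (q e) k * s k - ∑ k, a (q e) k * t k))
        - (∑ k, b (p e) k * s k - ∑ k, b (q e) k * s k)
          * ((∑ k, b (p e) k * s k - ∑ k, b (p e) k * t k)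
            - (∑ k, b (q e) k * s k - ∑ k, b (q e) k * t k))
        - (∑ k, b (p e) k * t k - ∑ k, b (q e) k * t k)
          * ((∑ k, b (p e) k * s k - ∑ k, b (p e) k * t k)
            - (∑ k, b (q e) k * s k - ∑ k, b (q e) k * t k)) := by
      simp only [G, X, Y, Pi.sub_apply]
      ring
    rw [hval, Real.norm_eq_abs]
    rw [abs_le] at *
    constructor <;> linarith [h0.1, h0.2, q1.1, q1.2, q2.1, q2.2, q3.1, q3.2, q4.1, q4.2]
  have hG0 : ‖G 0‖ ≤ ρ / 2 := by
    rw [pi_norm_le_iff_of_nonneg (by positivity)]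
    intro e
    have := hres e
    rw [← abs_neg] at this
    simpa [G, X, Y] using this
  have hmaps : Set.MapsTo G (Metric.closedBall 0 ρ) (Metric.closedBall 0 ρ) := by
    intro t ht
    rw [mem_closedBall_zero_iff] at ht ⊢
    have h1 := hG t 0 ht (by simpa using hρ)
    have h2 := norm_add_le (G t - G 0) (G 0)
    rw [sub_add_cancel] at h2
    rw [sub_zero] at h1
    linarith
  have hcontr : ContractingWith (1 / 2) (hmaps.restrict G _ _) := by
    refine ⟨by rw [← NNReal.coe_lt_coe]; norm_num, LipschitzWith.of_dist_le_mul ?_⟩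
    rintro ⟨s, hs⟩ ⟨t, ht⟩
    rw [mem_closedBall_zero_iff] at hs ht
    simpa [Subtype.dist_eq, dist_eq_norm] using hG s t hs ht
  obtain ⟨t, ht, hfix, -⟩ := hcontr.exists_fixedPoint' Metric.isClosed_closedBall.isComplete hmaps
    (Metric.mem_closedBall_self hρ) (edist_ne_top _ _)
  rw [mem_closedBall_zero_iff] at ht
  refine ⟨X t, Y t, fun v => ⟨?_, fun h => by simp [X, h]⟩, fun v => ⟨?_, fun h => by simp [Y, h]⟩,
    fun e => ?_⟩
  · simpa [X] using (hX v t).trans (mul_le_mul_of_nonneg_left ht hM)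
  · simpa [Y] using (hY v t).trans (mul_le_mul_of_nonneg_left ht hM)
  · have := congrFun hfix e
    simp only [G] at this
    linarith

/-- Approximate coordinates of the vertices of a quarter of the graph, in units of `10 ^ (-8)`. -/
def quarterApprox : List (ℤ × ℤ) :=
  [(422311240, 0), (322564456, 7111899), (222817672, 0), (194113476, 95791801), (165409279, 0),
   (97310231, 73229227), (0, 50191890), (28704196, 145983690), (27669383, 245978336),
   (0, 342074149), (97056107, 317988631), (194112213, 293903113), (291168320, 269817595),
   (334882626, 179878397), (378596933, 89939198), (235135843, 186990295), (278850149, 97051097),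
   (126014428, 169021027), (221781596, 197807300), (124725489, 221892818)]

/-- The edges of a quarter of the graph. -/
def quarterEdges : List (ℕ × ℕ) :=
  [(0, 1), (1, 2), (2, 3), (3, 4), (4, 5), (5, 6), (6, 7), (7, 8), (8, 9), (9, 10), (10, 11),
   (11, 12), (12, 13), (13, 14), (14, 0), (1, 14), (3, 15), (15, 16), (16, 1), (16, 14),
   (16, 13), (15, 13), (15, 12), (3, 17), (17, 18), (18, 12), (5, 17), (7, 5), (7, 17), (8, 19),
   (19, 18), (10, 8), (10, 19), (11, 19), (11, 18)]

/-- The rows, for the first coordinates of the vertices, of an approximate inverse of the Jacobian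
matrix of the squared edge lengths, in units of `10 ^ (-3)`. -/
def invJacobianX : List (List ℤ) :=
  [[152, 108, 377, -866, -365, -141, 34, -168, -174, 696, 683, 670, 726, 762, 797, -36, -630, 89,
    53, 36, -36, 36, -594, 145, 22, 0, -144, -223, 165, -39, -26, -13, 13, -13, 13],
   [-359, 105, 364, -842, -355, -135, 32, -166, -173, 690, 677, 665, 722, 770, 818, -48, -614,
    73, 24, 48, -48, 48, -592, 139, 25, 2, -137, -219, 162, -39, -26, -12, 12, -12, 12],
   [-368, -400, 350, -818, -345, -128, 31, -164, -171, 684, 672, 661, 717, 778, 840, -61, -598,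
    57, -4, 61, -61, 61, -591, 132, 28, 5, -131, -215, 159, -39, -27, -12, 12, -12, 12],
   [-260, -290, -1008, 372, 157, 180, -43, -59, -94, 374, 402, 429, 491, 542, 593, -51, -533, 54,
    3, 51, -51, 51, -523, -168, 177, 132, 181, -24, 3, -46, -73, 27, -27, 27, -27],
   [-152, -180, -624, -180, 658, 488, -117, 45, -16, 65, 131, 197, 265, 306, 347, -41, -468, 52,
    11, 41, -41, 41, -455, -469, 327, 259, 493, 168, -152, -52, -119, 66, -66, 66, -66],
   [-26, -27, -92, 31, 13, 479, -115, -25, -19, 74, 65, 56, 54, 57, 59, -2, -16, 1, -2, 2, -2, 2,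
    -16, -61, -36, -30, 59, 87, -96, 2, 11, -9, 9, -9, 9],
   [],
   [-108, -110, -384, 127, 54, 245, -59, -104, -77, 309, 270, 232, 226, 236, 247, -10, -65, 3,
    -8, 10, -10, 10, -68, -255, -149, -127, 245, -191, -397, 7, 46, -39, 39, -39, 39],
   [-48, -49, -170, 57, 24, 126, -30, -117, -107, 429, 266, 103, 100, 105, 110, -5, -29, 1, -3,
    5, -5, 5, -30, -113, 181, -56, 126, -102, 62, -428, -265, -163, 163, -163, 163],
   [],
   [-12, -12, -43, 14, 6, 32, -8, -29, -131, 523, 67, 26, 25, 26, 27, -1, -7, 0, -1, 1, -1, 1,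
    -8, -28, 45, -14, 32, -26, 15, -107, -66, 98, 41, -41, 41],
   [-24, -25, -85, 28, 12, 63, -15, -59, -123, 492, 549, 52, 50, 53, 55, -2, -14, 1, -2, 2, -2,
    2, -15, -57, 91, -28, 63, -51, 31, -76, -133, 57, -57, 57, 82],
   [-36, -37, -128, 43, 18, 95, -23, -88, -115, 460, 477, 493, 75, 79, 82, -3, -22, 1, -3, 3, -3,
    3, -23, -85, 136, 97, 95, -77, 46, -44, -60, 17, -17, 17, -17],
   [-147, 12, 40, -260, -110, 16, -4, -115, -135, 539, 545, 552, 611, 493, 334, 159, -224, -316,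
    -157, -159, 159, 360, -559, -8, 98, 64, 15, -125, 86, -42, -49, 7, -7, 7, -7],
   [-257, 60, 209, -563, -237, -62, 15, -141, -155, 617, 614, 611, 669, 867, 586, 321, -427,
    -114, -311, 198, -198, 198, -576, 68, 60, 32, -64, -174, 126, -40, -37, -3, 3, -3, 3],
   [-138, 8, 27, -236, -100, 22, -5, -113, -133, 532, 540, 547, 607, 461, 314, 146, -208, -291,
    -145, -146, 146, -146, -558, -15, 101, 67, 22, -122, 83, -42, -50, 7, -7, 7, -7],
   [-248, 56, 195, -539, -227, -56, 13, -139, -153, 611, 609, 606, 664, 875, 566, 308, -411,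
    -130, -299, -308, -211, 211, -575, 62, 63, 35, -58, -170, 123, -40, -38, -2, 2, -2, 2],
   [-134, -137, -476, 158, 67, 171, -41, -129, -96, 384, 335, 287, 280, 293, 306, -13, -80, 3,
    -10, 13, -13, 13, -84, -316, -185, -157, 171, -104, 60, 8, 57, -48, 48, -48, 48],
   [-72, -74, -256, 85, 36, 189, -45, -176, -92, 365, 260, 154, 151, 158, 164, -7, -43, 2, -5, 7,
    -7, 7, -45, -170, 272, -85, 189, -153, 93, 51, 157, -105, 105, -105, 105],
   [-60, -61, -213, 71, 30, 157, -38, -147, -100, 397, 332, 129, 126, 131, 137, -6, -36, 1, -4,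
    6, -6, 6, -38, -141, 226, -70, 158, -128, 77, 19, -332, -65, 65, -204, 204]]

/-- The rows, for the second coordinates of the vertices, of an approximate inverse of the Jacobian
matrix of the squared edge lengths, in units of `10 ^ (-3)`. -/
def invJacobianY : List (List ℤ) :=
  [[],
   [-130, -54, -187, 336, 142, 87, -21, 29, 22, -87, -76, -65, -64, 116, 296, -180, 225, -225,
    -405, 180, -180, 180, 19, -85, 42, 36, 88, 54, -44, -2, -13, 11, -11, 11, -11],
   [],
   [32, 33, 115, 357, 150, 92, -22, 31, 23, -93, -81, -69, -68, -71, -74, 3, 19, -1, 2, -3, 3,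
    -3, 20, -90, 45, 38, 94, 57, -47, -2, -14, 12, -12, 12, -12],
   [],
   [117, 142, 495, 196, 83, -9, 2, -65, -2, 9, -62, -132, -196, -232, -267, 35, 421, -48, -12,
    -35, 35, -35, 408, 379, -337, -269, -404, -75, 53, 50, 121, -70, 70, -70, 70],
   [7, 30, 105, 325, 137, -156, -484, -170, -81, 323, 213, 103, 33, 8, -17, 25, 355, -45, -20,
    -25, 25, -25, 339, 121, -489, -398, -155, 292, -351, 57, 167, -110, 110, -110, 110],
   [40, 63, 220, 287, 121, -229, 55, -139, -58, 230, 132, 34, -34, -62, -91, 28, 374, -46, -18,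
    -28, 28, -28, 360, 197, -444, -360, -228, 350, -232, 55, 153, -98, 98, -98, 98],
   [40, 64, 222, 286, 121, -231, 55, 361, -58, 231, 132, 33, -36, -64, -92, 28, 375, -46, -18,
    -28, 28, -28, 360, 198, -441, -359, -230, 351, -227, 51, 150, -99, 99, -99, 99],
   [54, 78, 271, 270, 114, -267, 64, 394, 493, 108, 55, 3, -65, -94, -123, 29, 383, -46, -17,
    -29, 29, -29, 369, 231, -493, -343, -266, 380, -245, 174, 226, -52, 52, -52, 52],
   [6, 28, 99, 327, 138, -140, 34, 276, -35, 140, 324, 107, 37, 12, -13, 25, 354, -45, -20, -25,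
    25, -25, 338, 117, -310, -400, -139, 277, -182, -258, -42, 343, 217, -217, 217],
   [-43, -21, -73, 384, 162, -13, 3, 157, -3, 13, 192, 211, 138, 118, 98, 20, 325, -44, -24, -20,
    20, -20, 308, 3, -127, -456, -11, 174, -120, -130, -309, 179, -179, 179, 381],
   [-91, -71, -246, 442, 186, 114, -28, 39, 29, -115, -100, -86, 240, 224, 208, 16, 295, -43,
    -27, -16, 16, -16, 278, -112, 55, 47, 116, 71, -58, -3, -17, 14, -14, 14, -14],
   [-145, -47, -164, 294, 124, 76, -18, 26, 19, -76, -67, -57, -56, 425, 331, 95, 197, -197,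
    -102, -95, 95, 158, 17, -74, 37, 31, 77, 47, -39, -2, -11, 10, -10, 10, -10],
   [-199, -24, -82, 147, 62, 38, -9, 13, 10, -38, -33, -29, -28, 51, 453, 173, 98, -98, -177, 79,
    -79, 79, 8, -37, 18, 16, 39, 24, -19, -1, -6, 5, -5, 5, -5],
   [-23, -101, -350, 630, 266, 163, -39, 55, 41, -164, -143, -123, -120, -34, 51, -86, 422, 155,
    69, 86, -86, 86, 36, -159, 79, 67, 165, 101, -82, -4, -24, 21, -21, 21, -21],
   [-76, -77, -269, 483, 204, 125, -30, 42, 31, -126, -110, -94, -92, 167, 174, -7, 323, -323,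
    -6, 7, -259, 259, 28, -122, 61, 51, 127, 78, -63, -3, -19, 16, -16, 16, -16],
   [149, 175, 610, 158, 66, 84, -20, -34, 21, -84, -143, -201, -264, -302, -341, 39, 440, -48,
    -10, -39, 39, -39, 429, 456, -292, -231, 84, -18, 6, 48, 107, -59, 59, -59, 59],
   [-57, -35, -122, 401, 169, 24, -6, 123, 6, -24, 108, 240, 167, 148, 129, 19, 316, -44, -25,
    -19, 19, -19, 299, -30, -75, -473, 25, 145, -102, -94, -226, 132, -132, 132, -132],
   [-8, 14, 50, 343, 145, -103, 25, 242, -26, 104, 400, 137, 66, 42, 19, 24, 345, -45, -21, -24,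
    24, -24, 330, 84, -258, -416, -102, 248, -165, -222, -118, 297, -297, -264, 264]]

/-- The approximate coordinates of vertex `i` of the quarter. -/
def quarterPoint (i : ℕ) : ℤ × ℤ := quarterApprox.getD i 0

/-- The `k`-th edge of the quarter. -/
def quarterEdge (k : ℕ) : ℕ × ℕ := quarterEdges.getD k (0, 0)

/-- The entry of the table `L` in row `i` and column `k`; missing entries are zero. -/
def tableEntry (L : List (List ℤ)) (i k : ℕ) : ℤ := (L.getD i []).getD k 0

/-- The vertices of the quarter on the vertical axis of symmetry. -/
def onVerticalAxis (i : ℕ) : Bool := i == 6 || i == 9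

/-- The vertices of the quarter on the horizontal axis of symmetry. -/
def onHorizontalAxis (i : ℕ) : Bool := i == 0 || i == 2 || i == 4

theorem sum_abs_tableEntry_le : ∀ i : Fin 20,
    ∑ k : Fin 35, |tableEntry invJacobianX i k| ≤ 10000 ∧
    ∑ k : Fin 35, |tableEntry invJacobianY i k| ≤ 10000 := by
  decide +kernel

theorem quarterEdge_lt : ∀ k : Fin 35, (quarterEdge k).1 < 20 ∧ (quarterEdge k).2 < 20 := by
  decide +kernel

theorem abs_quarter_residual_le : ∀ e : Fin 35,
    |((quarterPoint (quarterEdge e).1).1 - (quarterPoint (quarterEdge e).2).1) ^ 2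
      + ((quarterPoint (quarterEdge e).1).2 - (quarterPoint (quarterEdge e).2).2) ^ 2
      - 10 ^ 16| ≤ 5 * 10 ^ 9 := by
  decide +kernel

theorem sum_abs_quarter_jacobian_le : ∀ e : Fin 35, ∑ k : Fin 35,
    |(if e = k then 10 ^ 11 else 0)
      - 2 * ((quarterPoint (quarterEdge e).1).1 - (quarterPoint (quarterEdge e).2).1)
        * (tableEntry invJacobianX (quarterEdge e).1 k
          - tableEntry invJacobianX (quarterEdge e).2 k)
      - 2 * ((quarterPoint (quarterEdge e).1).2 - (quarterPoint (quarterEdge e).2).2)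
        * (tableEntry invJacobianY (quarterEdge e).1 k
          - tableEntry invJacobianY (quarterEdge e).2 k)|
    ≤ 25 * 10 ^ 9 := by
  decide +kernel

theorem tableEntry_eq_zero : ∀ i : Fin 20,
    (onVerticalAxis i → (quarterPoint i).1 = 0 ∧ ∀ k : Fin 35, tableEntry invJacobianX i k = 0) ∧
    (onHorizontalAxis i → (quarterPoint i).2 = 0 ∧
      ∀ k : Fin 35, tableEntry invJacobianY i k = 0) := by
  decide +kernel

/-- The quarter of the graph exists, near its approximate coordinates. -/
theorem exists_quarter : ∃ X Y : ℕ → ℝ,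
    (∀ i < 20, |10 ^ 8 * X i - (quarterPoint i).1| ≤ 1000 ∧
      |10 ^ 8 * Y i - (quarterPoint i).2| ≤ 1000) ∧
    (∀ i < 20, onVerticalAxis i → X i = 0) ∧ (∀ i < 20, onHorizontalAxis i → Y i = 0) ∧
    ∀ e ∈ quarterEdges, (X e.1 - X e.2) ^ 2 + (Y e.1 - Y e.2) ^ 2 = 1 := by
  refine Exists.elim (exists_unit_distances
    (fun e : Fin 35 => (⟨_, (quarterEdge_lt e).1⟩ : Fin 20)) (fun e => ⟨_, (quarterEdge_lt e).2⟩)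
    (fun i => (quarterPoint i).1 / 10 ^ 8) (fun i => (quarterPoint i).2 / 10 ^ 8)
    (fun i k => tableEntry invJacobianX i k / 10 ^ 3)
    (fun i k => tableEntry invJacobianY i k / 10 ^ 3)
    (M := 10) (ρ := 1 / 10 ^ 6) (by norm_num) (by norm_num) (by norm_num) ?_ ?_ ?_ ?_) ?_
  · intro i
    have h : ((∑ k : Fin 35, |tableEntry invJacobianX i k| : ℤ) : ℝ) ≤ (10000 : ℤ) :=
      Int.cast_le.2 (sum_abs_tableEntry_le i).1
    push_cast at h
    simp only [abs_div, ← Finset.sum_div]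
    norm_num
    linarith
  · intro i
    have h : ((∑ k : Fin 35, |tableEntry invJacobianY i k| : ℤ) : ℝ) ≤ (10000 : ℤ) :=
      Int.cast_le.2 (sum_abs_tableEntry_le i).2
    push_cast at h
    simp only [abs_div, ← Finset.sum_div]
    norm_num
    linarith
  · intro e
    have h := (Int.cast_le (R := ℝ)).2 (abs_quarter_residual_le e)
    push_cast at h
    rw [abs_le] at *
    constructor <;> linarith [h.1, h.2]
  · intro e
    have h := (Int.cast_le (R := ℝ)).2 (sum_abs_quarter_jacobian_le e)
    push_cast at h
    refine le_trans (le_of_eq ?_) ((div_le_div_of_nonneg_right h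
      (by norm_num : (0 : ℝ) ≤ 10 ^ 11)).trans (by norm_num))
    rw [Finset.sum_div]
    refine Finset.sum_congr rfl fun k _ => ?_
    rw [← abs_of_nonneg (by norm_num : (0 : ℝ) ≤ 10 ^ 11), ← abs_div]
    congr 1
    split_ifs <;> ring
  · rintro X ⟨Y, hX, hY, hXY⟩
    refine ⟨fun i => if h : i < 20 then X ⟨i, h⟩ else 0,
      fun i => if h : i < 20 then Y ⟨i, h⟩ else 0,
      fun i hi => ?_, fun i hi h => ?_, fun i hi h => ?_, fun e he => ?_⟩
    · have h1 := (hX ⟨i, hi⟩).1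
      have h2 := (hY ⟨i, hi⟩).1
      simp only [hi, dif_pos]
      rw [abs_le] at h1 h2 ⊢
      rw [abs_le]
      constructor <;> constructor <;> linarith [h1.1, h1.2, h2.1, h2.2]
    · obtain ⟨h0, hk⟩ := (tableEntry_eq_zero ⟨i, hi⟩).1 h
      simp only [hi, dif_pos]
      rw [(hX ⟨i, hi⟩).2 fun k => by simp [hk k]]
      simp [h0]
    · obtain ⟨h0, hk⟩ := (tableEntry_eq_zero ⟨i, hi⟩).2 h
      simp only [hi, dif_pos]
      rw [(hY ⟨i, hi⟩).2 fun k => by simp [hk k]]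
      simp [h0]
    · obtain ⟨k, hk, rfl⟩ := List.mem_iff_getElem.1 he
      have hlt := quarterEdge_lt ⟨k, hk⟩
      have h := hXY ⟨k, hk⟩
      have hval : quarterEdge k = quarterEdges[k] := List.getD_eq_getElem _ _ hk
      simp only [hval] at h hlt
      simpa only [hlt.1, hlt.2, dif_pos] using h

/-- Two unit segments with a common endpoint meet only in that endpoint. -/
theorem segment_inter_subset_of_dist_eq_one {a b c : EuclideanSpace ℝ (Fin 2)}
    (hab : dist a b = 1) (hac : dist a c = 1) (hbc : b ≠ c) :
    segment ℝ a b ∩ segment ℝ a c ⊆ {a} := by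
  rintro z ⟨hb, hc⟩
  rw [segment_eq_image'] at hb hc
  obtain ⟨t, ht, rfl⟩ := hb
  obtain ⟨s, hs, hst⟩ := hc
  simp only at hst
  have heq : s • (c - a) = t • (b - a) := add_left_cancel hst
  have hnorm := congrArg norm heq
  rw [norm_smul, norm_smul, ← dist_eq_norm, ← dist_eq_norm, dist_comm c, dist_comm b, hab, hac,
    Real.norm_of_nonneg hs.1, Real.norm_of_nonneg ht.1, mul_one, mul_one] at hnorm
  subst hnorm
  rcases eq_or_ne s 0 with rfl | h0
  · simp
  · exact absurd (sub_left_injective (smul_right_injective _ h0 heq)).symm hbc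

/-- A drawing of a graph by unit segments, any two of which meet only in common endpoints, is a
matchstick graph. -/
theorem exists_matchstickGraph {ι : Type*} [BEq ι] [LawfulBEq ι] (verts : List ι)
    (edges : List (ι × ι)) (pos : ι → EuclideanSpace ℝ (Fin 2)) (hverts : verts.Nodup)
    (hinj : ∀ a ∈ verts, ∀ b ∈ verts, pos a = pos b → a = b)
    (hmem : ∀ e ∈ edges, e.1 ∈ verts ∧ e.2 ∈ verts)
    (hunit : ∀ e ∈ edges, dist (pos e.1) (pos e.2) = 1)
    (hedges : edges.Pairwise fun e f => s(e.1, e.2) ≠ s(f.1, f.2))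
    (hcross : edges.Pairwise fun e f =>
      segment ℝ (pos e.1) (pos e.2) ∩ segment ℝ (pos f.1) (pos f.2)
        ⊆ ({pos e.1, pos e.2} : Set (EuclideanSpace ℝ (Fin 2))) ∩ {pos f.1, pos f.2})
    (hdeg : ∀ v ∈ verts, edges.countP (fun e => v == e.1 || v == e.2) = 4) :
    ∃ G : MatchstickGraph, G.IsFourRegular ∧ G.V.card = verts.length := by
  let seg : ι × ι → Sym2 (EuclideanSpace ℝ (Fin 2)) := fun e => s(pos e.1, pos e.2)
  have hends : ∀ e : ι × ι, ∀ u v : EuclideanSpace ℝ (Fin 2), seg e = s(u, v) →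
      segment ℝ u v = segment ℝ (pos e.1) (pos e.2) ∧
        ({u, v} : Set (EuclideanSpace ℝ (Fin 2))) = {pos e.1, pos e.2} := by
    intro e u v h
    rcases Sym2.eq_iff.1 h with ⟨rfl, rfl⟩ | ⟨rfl, rfl⟩
    · exact ⟨rfl, rfl⟩
    · exact ⟨segment_symm _ _ _, Set.pair_comm _ _⟩
  have hne : ∀ e ∈ edges, pos e.1 ≠ pos e.2 := by
    intro e he h
    simpa [h] using hunit e he
  have hall : ∀ e ∈ edges, ∀ f ∈ edges, e ≠ f →
      segment ℝ (pos e.1) (pos e.2) ∩ segment ℝ (pos f.1) (pos f.2)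
        ⊆ ({pos e.1, pos e.2} : Set (EuclideanSpace ℝ (Fin 2))) ∩ {pos f.1, pos f.2} := by
    have : Std.Symm fun e f : ι × ι =>
        segment ℝ (pos e.1) (pos e.2) ∩ segment ℝ (pos f.1) (pos f.2)
          ⊆ ({pos e.1, pos e.2} : Set (EuclideanSpace ℝ (Fin 2))) ∩ {pos f.1, pos f.2} := by
      refine ⟨fun e f h => ?_⟩
      rwa [Set.inter_comm, Set.inter_comm {pos f.1, pos f.2}]
    exact fun e he f hf hef => hcross.forall he hf hef
  let G : MatchstickGraph :=
    { V := (verts.map pos).toFinset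
      E := (edges.map seg).toFinset
      edge_mem := by
        intro e he u v huv
        obtain ⟨k, hk, rfl⟩ := List.mem_map.1 (List.mem_toFinset.1 he)
        simp only [List.mem_toFinset, List.mem_map]
        rcases Sym2.eq_iff.1 huv with ⟨rfl, rfl⟩ | ⟨rfl, rfl⟩
        · exact ⟨⟨_, (hmem k hk).1, rfl⟩, _, (hmem k hk).2, rfl⟩
        · exact ⟨⟨_, (hmem k hk).2, rfl⟩, _, (hmem k hk).1, rfl⟩
      edge_ne := by
        intro e he
        obtain ⟨k, hk, rfl⟩ := List.mem_map.1 (List.mem_toFinset.1 he)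
        exact fun h => hne k hk (Sym2.mk_isDiag_iff.1 h)
      edge_unit := by
        intro e he u v huv
        obtain ⟨k, hk, rfl⟩ := List.mem_map.1 (List.mem_toFinset.1 he)
        rcases Sym2.eq_iff.1 huv with ⟨rfl, rfl⟩ | ⟨rfl, rfl⟩
        · exact hunit k hk
        · rw [dist_comm]
          exact hunit k hk
      noncross := by
        intro e he f hf hef u v x y huv hxy
        obtain ⟨k, hk, rfl⟩ := List.mem_map.1 (List.mem_toFinset.1 he)
        obtain ⟨l, hl, rfl⟩ := List.mem_map.1 (List.mem_toFinset.1 hf)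
        rw [(hends k u v huv).1, (hends k u v huv).2, (hends l x y hxy).1, (hends l x y hxy).2]
        exact hall k hk l hl fun h => hef (congrArg seg h) }
  refine ⟨G, ?_, ?_⟩
  · intro v hv
    obtain ⟨i, hi, rfl⟩ := List.mem_map.1 (List.mem_toFinset.1 hv)
    have hnodup : (edges.map seg).Nodup := by
      refine List.pairwise_map.2 (hedges.imp_of_mem ?_)
      intro e f he hf hef h
      refine hef ?_
      rcases Sym2.eq_iff.1 h with ⟨h1, h2⟩ | ⟨h1, h2⟩
      · rw [hinj _ (hmem e he).1 _ (hmem f hf).1 h1, hinj _ (hmem e he).2 _ (hmem f hf).2 h2]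
      · rw [hinj _ (hmem e he).1 _ (hmem f hf).2 h1, hinj _ (hmem e he).2 _ (hmem f hf).1 h2,
          Sym2.eq_swap]
    rw [← hdeg i hi]
    have hfilter : G.E.filter (fun e => pos i ∈ e)
        = ((edges.map seg).filter fun e => decide (pos i ∈ e)).toFinset := by
      ext e
      simp [G]
    rw [MatchstickGraph.degree, hfilter, List.toFinset_card_of_nodup (hnodup.filter _),
      ← List.countP_eq_length_filter, List.countP_map]
    refine List.countP_congr fun e he => ?_
    simp only [Function.comp_apply, decide_eq_true_eq, seg, Sym2.mem_iff, Bool.or_eq_true,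
      beq_iff_eq]
    constructor
    · rintro (h | h)
      · exact Or.inl (hinj _ hi _ (hmem e he).1 h)
      · exact Or.inr (hinj _ hi _ (hmem e he).2 h)
    · rintro (h | h)
      · exact Or.inl (congrArg pos h)
      · exact Or.inr (congrArg pos h)
  · change ((verts.map pos).toFinset).card = _
    rw [List.toFinset_card_of_nodup, List.length_map]
    exact hverts.map_on hinj

/-- The four reflections, as pairs of Booleans that tell which coordinates change sign. -/
def reflections : List (Bool × Bool) :=
  [(false, false), (false, true), (true, false), (true, true)]

/-- The canonical name of the image of vertex `i` of the quarter under a reflection: vertices on an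
axis of symmetry are fixed by the reflection in that axis. -/
def reflectedNode (i : ℕ) (s : Bool × Bool) : ℕ × Bool × Bool :=
  (i, s.1 && !onVerticalAxis i, s.2 && !onHorizontalAxis i)

/-- The vertices of the graph. -/
def nodes : List (ℕ × Bool × Bool) :=
  (List.range 20 ×ˢ reflections).filter fun v => reflectedNode v.1 v.2 == v

/-- The edges of the graph. -/
def links : List ((ℕ × Bool × Bool) × (ℕ × Bool × Bool)) :=
  (quarterEdges ×ˢ reflections).map fun e => (reflectedNode e.1.1 e.2, reflectedNode e.1.2 e.2)

/-- The number `x` or its negative. -/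
def signed {R : Type*} [Neg R] (b : Bool) (x : R) : R := cond b (-x) x

/-- The approximate coordinates of a vertex of the graph. -/
def nodeApprox (v : ℕ × Bool × Bool) : ℤ × ℤ :=
  (signed v.2.1 (quarterPoint v.1).1, signed v.2.2 (quarterPoint v.1).2)

/-- Points with approximate coordinates `A` have smaller inner product with `n` than points with
approximate coordinates `B`. -/
def separates (A B n : ℤ × ℤ) : Bool :=
  n.1 * A.1 + n.2 * A.2 + 2000 * (|n.1| + |n.2|) < n.1 * B.1 + n.2 * B.2

/-- Candidates for a normal vector of a line separating the segments `AB` and `CD`. -/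
def normals (A B C D : ℤ × ℤ) : List (ℤ × ℤ) :=
  [(1, 0), (-1, 0), (0, 1), (0, -1), (A.2 - B.2, B.1 - A.1), (B.2 - A.2, A.1 - B.1),
    (C.2 - D.2, D.1 - C.1), (D.2 - C.2, C.1 - D.1)]

/-- The segments `AB` and `CD` are separated by one of the candidate directions. -/
def segmentsSeparated (A B C D : ℤ × ℤ) : Bool :=
  (normals A B C D).any fun n =>
    separates A C n && separates A D n && separates B C n && separates B D n

/-- Two edges are distinct, and they have a common vertex or are separated by a line. -/
def linksCompatible (e f : (ℕ × Bool × Bool) × (ℕ × Bool × Bool)) : Bool :=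
  e != f && e != f.swap && (e.1 == f.1 || e.1 == f.2 || e.2 == f.1 || e.2 == f.2 ||
    segmentsSeparated (nodeApprox e.1) (nodeApprox e.2) (nodeApprox f.1) (nodeApprox f.2))

theorem nodes_nodup : nodes.Nodup := by
  decide +kernel

theorem length_nodes : nodes.length = 70 := by
  decide +kernel

theorem mem_nodes_of_mem_links : ∀ e ∈ links, e.1 ∈ nodes ∧ e.2 ∈ nodes := by
  decide +kernel

theorem countP_links : ∀ v ∈ nodes, links.countP (fun e => v == e.1 || v == e.2) = 4 := by
  decide +kernel

theorem nodeApprox_separated : nodes.Pairwise fun v w =>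
    2000 < |(nodeApprox v).1 - (nodeApprox w).1| ∨ 2000 < |(nodeApprox v).2 - (nodeApprox w).2| := by
  decide +kernel

theorem links_pairwise_compatible : links.Pairwise fun e f => linksCompatible e f = true := by
  decide +kernel

/-- The point `p` lies within `10 ^ (-5)` of the point with approximate coordinates `A`, in each
coordinate. -/
def IsNear (p : EuclideanSpace ℝ (Fin 2)) (A : ℤ × ℤ) : Prop :=
  |10 ^ 8 * p 0 - A.1| ≤ 1000 ∧ |10 ^ 8 * p 1 - A.2| ≤ 1000

theorem IsNear.lt_of_separates {p q : EuclideanSpace ℝ (Fin 2)} {A B n : ℤ × ℤ}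
    (hp : IsNear p A) (hq : IsNear q B) (h : separates A B n = true) :
    n.1 * p 0 + n.2 * p 1 < n.1 * q 0 + n.2 * q 1 := by
  have herr : ∀ (r : EuclideanSpace ℝ (Fin 2)) (C : ℤ × ℤ), IsNear r C →
      |10 ^ 8 * (n.1 * r 0 + n.2 * r 1) - (n.1 * C.1 + n.2 * C.2)|
        ≤ 1000 * (|(n.1 : ℝ)| + |(n.2 : ℝ)|) := by
    intro r C hr
    calc |10 ^ 8 * (n.1 * r 0 + n.2 * r 1) - (n.1 * C.1 + n.2 * C.2)|
        = |n.1 * (10 ^ 8 * r 0 - C.1) + n.2 * (10 ^ 8 * r 1 - C.2)| := by congr 1; ring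
      _ ≤ |(n.1 : ℝ)| * |10 ^ 8 * r 0 - C.1| + |(n.2 : ℝ)| * |10 ^ 8 * r 1 - C.2| := by
          rw [← abs_mul, ← abs_mul]
          exact abs_add_le _ _
      _ ≤ |(n.1 : ℝ)| * 1000 + |(n.2 : ℝ)| * 1000 :=
          add_le_add (mul_le_mul_of_nonneg_left hr.1 (abs_nonneg _))
            (mul_le_mul_of_nonneg_left hr.2 (abs_nonneg _))
      _ = 1000 * (|(n.1 : ℝ)| + |(n.2 : ℝ)|) := by ring
  have hsep := (Int.cast_lt (R := ℝ)).2 (of_decide_eq_true h)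
  push_cast at hsep
  linarith [(abs_le.1 (herr p A hp)).2, (abs_le.1 (herr q B hq)).1]

theorem disjoint_segment_of_segmentsSeparated {a b c d : EuclideanSpace ℝ (Fin 2)}
    {A B C D : ℤ × ℤ} (ha : IsNear a A) (hb : IsNear b B) (hc : IsNear c C) (hd : IsNear d D)
    (h : segmentsSeparated A B C D = true) : Disjoint (segment ℝ a b) (segment ℝ c d) := by
  obtain ⟨n, -, hn⟩ := List.any_eq_true.1 h
  simp only [Bool.and_eq_true] at hn
  obtain ⟨⟨⟨hac, had⟩, hbc⟩, hbd⟩ := hn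
  have hac := ha.lt_of_separates hc hac
  have had := ha.lt_of_separates hd had
  have hbc := hb.lt_of_separates hc hbc
  have hbd := hb.lt_of_separates hd hbd
  rw [Set.disjoint_left]
  rintro z ⟨s, t, hs, ht, hst, rfl⟩ ⟨u, v, hu, hv, huv, hz⟩
  have h0 := congrFun (congrArg WithLp.ofLp hz) 0
  have h1 := congrFun (congrArg WithLp.ofLp hz) 1
  simp only [PiLp.add_apply, PiLp.smul_apply, smul_eq_mul] at h0 h1
  set m := max (n.1 * a 0 + n.2 * a 1) (n.1 * b 0 + n.2 * b 1)
  set M := min (n.1 * c 0 + n.2 * c 1) (n.1 * d 0 + n.2 * d 1)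
  have hmM : m < M := max_lt (lt_min hac had) (lt_min hbc hbd)
  have hm : s * (n.1 * a 0 + n.2 * a 1) + t * (n.1 * b 0 + n.2 * b 1) ≤ m :=
    calc _ ≤ s * m + t * m := add_le_add (mul_le_mul_of_nonneg_left (le_max_left _ _) hs)
            (mul_le_mul_of_nonneg_left (le_max_right _ _) ht)
      _ = m := by rw [← add_mul, hst, one_mul]
  have hM : M ≤ u * (n.1 * c 0 + n.2 * c 1) + v * (n.1 * d 0 + n.2 * d 1) :=
    calc M = u * M + v * M := by rw [← add_mul, huv, one_mul]
      _ ≤ _ := add_le_add (mul_le_mul_of_nonneg_left (min_le_left _ _) hu)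
            (mul_le_mul_of_nonneg_left (min_le_right _ _) hv)
  have heq : u * (n.1 * c 0 + n.2 * c 1) + v * (n.1 * d 0 + n.2 * d 1)
      = s * (n.1 * a 0 + n.2 * a 1) + t * (n.1 * b 0 + n.2 * b 1) := by
    linear_combination (n.1 : ℝ) * h0 + (n.2 : ℝ) * h1
  linarith

/-- The position of a vertex of the graph, given the coordinates of the quarter. -/
noncomputable def nodePos (X Y : ℕ → ℝ) (v : ℕ × Bool × Bool) : EuclideanSpace ℝ (Fin 2) :=
  !₂[signed v.2.1 (X v.1), signed v.2.2 (Y v.1)]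

theorem isNear_nodePos {X Y : ℕ → ℝ} {v : ℕ × Bool × Bool}
    (hX : |10 ^ 8 * X v.1 - (quarterPoint v.1).1| ≤ 1000)
    (hY : |10 ^ 8 * Y v.1 - (quarterPoint v.1).2| ≤ 1000) :
    IsNear (nodePos X Y v) (nodeApprox v) := by
  have hsigned : ∀ (b : Bool) (x : ℝ) (c : ℤ),
      |10 ^ 8 * signed b x - (signed b c : ℤ)| = |10 ^ 8 * x - c| := by
    intro b x c
    cases b
    · rfl
    · rw [← abs_neg]
      simp only [signed, cond_true, Int.cast_neg]
      congr 1
      ring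
  exact ⟨(hsigned _ _ _).trans_le hX, (hsigned _ _ _).trans_le hY⟩

theorem nodePos_reflectedNode {X Y : ℕ → ℝ} {i : ℕ} (hX : onVerticalAxis i = true → X i = 0)
    (hY : onHorizontalAxis i = true → Y i = 0) (s : Bool × Bool) :
    nodePos X Y (reflectedNode i s) = nodePos X Y (i, s) := by
  have hsigned : ∀ (b c : Bool) (x : ℝ), (c = true → x = 0) → signed (b && !c) x = signed b x := by
    intro b c x h
    cases c
    · simp
    · simp [signed, h rfl]
  simp only [nodePos, reflectedNode, hsigned _ _ _ hX, hsigned _ _ _ hY]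

theorem dist_nodePos_eq_one {X Y : ℕ → ℝ} {i j : ℕ}
    (h : (X i - X j) ^ 2 + (Y i - Y j) ^ 2 = 1) (s : Bool × Bool) :
    dist (nodePos X Y (i, s)) (nodePos X Y (j, s)) = 1 := by
  have hsigned : ∀ (b : Bool) (x y : ℝ), (signed b x - signed b y) ^ 2 = (x - y) ^ 2 := by
    intro b x y
    cases b
    · rfl
    · simp only [signed, cond_true]
      ring
  simp [EuclideanSpace.dist_eq, nodePos, Real.dist_eq, sq_abs, hsigned, h]

/-- There exists a 4-regular matchstick graph with exactly 70 vertices. -/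
theorem exists_fourRegular_matchstick_70 :
    ∃ G : MatchstickGraph, G.IsFourRegular ∧ G.V.card = 70 := by
  obtain ⟨X, Y, hnear, hX, hY, hdist⟩ := exists_quarter
  have hlt : ∀ v ∈ nodes, v.1 < 20 := fun v hv =>
    List.mem_range.1 (List.mem_product.1 (List.mem_of_mem_filter hv)).1
  have hpos : ∀ v ∈ nodes, IsNear (nodePos X Y v) (nodeApprox v) := fun v hv =>
    isNear_nodePos (hnear _ (hlt v hv)).1 (hnear _ (hlt v hv)).2
  have hinj : ∀ v ∈ nodes, ∀ w ∈ nodes, nodePos X Y v = nodePos X Y w → v = w := by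
    intro v hv w hw hvw
    by_contra hne
    have : Std.Symm fun v w : ℕ × Bool × Bool =>
        2000 < |(nodeApprox v).1 - (nodeApprox w).1| ∨
          2000 < |(nodeApprox v).2 - (nodeApprox w).2| := by
      refine ⟨fun v w h => ?_⟩
      rwa [abs_sub_comm, abs_sub_comm (nodeApprox w).2]
    have hclose : ∀ (x : ℝ) (a b : ℤ), |x - a| ≤ 1000 → |x - b| ≤ 1000 → |a - b| ≤ 2000 := by
      intro x a b ha hb
      rw [← Int.cast_le (R := ℝ)]
      push_cast
      rw [abs_le] at ha hb ⊢
      constructor <;> linarith [ha.1, ha.2, hb.1, hb.2]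
    have hv' := hpos v hv
    have hw' := hpos w hw
    rw [hvw] at hv'
    rcases nodeApprox_separated.forall hv hw hne with h | h
    · exact absurd (hclose _ _ _ hv'.1 hw'.1) (not_le.2 h)
    · exact absurd (hclose _ _ _ hv'.2 hw'.2) (not_le.2 h)
  have hunit : ∀ e ∈ links, dist (nodePos X Y e.1) (nodePos X Y e.2) = 1 := by
    intro e he
    obtain ⟨⟨⟨i, j⟩, s⟩, hk, rfl⟩ := List.mem_map.1 he
    have hi : i < 20 := hlt _ (mem_nodes_of_mem_links _ he).1
    have hj : j < 20 := hlt _ (mem_nodes_of_mem_links _ he).2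
    change dist (nodePos X Y (reflectedNode i s)) (nodePos X Y (reflectedNode j s)) = 1
    rw [nodePos_reflectedNode (hX _ hi) (hY _ hi), nodePos_reflectedNode (hX _ hj) (hY _ hj)]
    exact dist_nodePos_eq_one (hdist _ (List.mem_product.1 hk).1) s
  rw [← length_nodes]
  refine exists_matchstickGraph nodes links (nodePos X Y) nodes_nodup hinj mem_nodes_of_mem_links
    hunit ?_ ?_ countP_links
  · refine links_pairwise_compatible.imp fun {e f} h hef => ?_
    simp only [linksCompatible, Bool.and_eq_true, bne_iff_ne] at h
    rcases Sym2.eq_iff.1 hef with ⟨h1, h2⟩ | ⟨h1, h2⟩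
    · exact h.1.1 (Prod.ext h1 h2)
    · exact h.1.2 (Prod.ext h1 h2)
  · refine links_pairwise_compatible.imp_of_mem ?_
    rintro ⟨a, b⟩ ⟨c, d⟩ he hf h
    obtain ⟨ha, hb⟩ := mem_nodes_of_mem_links _ he
    obtain ⟨hc, hd⟩ := mem_nodes_of_mem_links _ hf
    have hab := hunit _ he
    have hcd := hunit _ hf
    simp only [linksCompatible, Bool.and_eq_true, bne_iff_ne, Bool.or_eq_true, beq_iff_eq,
      Prod.swap_prod_mk, ne_eq, Prod.mk.injEq, not_and] at h ha hb hc hd hab hcd ⊢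
    obtain ⟨⟨hne, hne'⟩, (((rfl | rfl) | rfl) | rfl) | hsep⟩ := h
    · have := segment_inter_subset_of_dist_eq_one hab hcd fun h => hne rfl (hinj _ hb _ hd h)
      exact this.trans (by simp)
    · rw [dist_comm] at hcd
      have := segment_inter_subset_of_dist_eq_one hab hcd fun h => hne' rfl (hinj _ hb _ hc h)
      rw [segment_symm ℝ (nodePos X Y c)]
      exact this.trans (by simp)
    · rw [dist_comm] at hab
      have := segment_inter_subset_of_dist_eq_one hab hcd fun h => hne' (hinj _ ha _ hd h) rfl
      rw [segment_symm ℝ (nodePos X Y a)]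
      exact this.trans (by simp)
    · rw [dist_comm] at hab hcd
      have := segment_inter_subset_of_dist_eq_one hab hcd fun h => hne (hinj _ ha _ hc h) rfl
      rw [segment_symm ℝ (nodePos X Y a), segment_symm ℝ (nodePos X Y c)]
      exact this.trans (by simp)
    · rw [(disjoint_segment_of_segmentsSeparated (hpos _ ha) (hpos _ hb) (hpos _ hc) (hpos _ hd)
        hsep).inter_eq]
      exact Set.empty_subset _
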